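/- Assume Σ_{i=1}^m p_i(n) < 1 for all n. Set α_i = liminf_{n→∞} Σ_{j=n+1}^{ρ_i(n)} p_i(j) and α = min_{1≤i≤m} α_i. If 0 < α ≤ 1/e and for some r ∈ ℕ, limsup_{n→∞} Σ_{j=n}^{ρ(n)} Σ_{i=1}^m p_i(j) b_r(ρ(n), σ_i(j))^{−1} > 1 − (1 − α − √(1 − 2α − α²))/2, then every solution of (E_A) oscillates. -/

import Mathlib

/-- `bA p σ r n k` is the quantity `b_{r+1}(n,k)` of the paper. -/
noncomputable def bA {m : ℕ} (p : Fin m → ℕ → ℝ) (σ : Fin m → ℕ → ℕ) : ℕ → ℕ → ℕ → ℝ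
  | 0, n, k => ∏ i ∈ Finset.Icc (n + 1) k, (1 - ∑ l : Fin m, p l i)
  | r + 1, n, k => ∏ i ∈ Finset.Icc (n + 1) k, (1 - ∑ l : Fin m, p l i * (bA p σ r i (σ l i))⁻¹)

/-- `ρ_i(n) = min_{s ≥ n} σ_i(s)`. -/
noncomputable def rhoi {m : ℕ} (σ : Fin m → ℕ → ℕ) (i : Fin m) (n : ℕ) : ℕ :=
  sInf (σ i '' Set.Ici n)

/-- `ρ(n) = min_{1 ≤ i ≤ m} ρ_i(n)`. -/
noncomputable def rho {m : ℕ} [NeZero m] (σ : Fin m → ℕ → ℕ) (n : ℕ) : ℕ :=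
  Finset.univ.inf' Finset.univ_nonempty (fun i => rhoi σ i n)

open Filter Finset

section Comparison

variable {x F : ℕ → ℝ} {ρ : ℕ → ℕ} {N : ℕ}

/-- A solution of the advanced inequality grows at least linearly in the mass `F`. -/
lemma add_mul_mass_le (hF : Monotone F) (hx : ∀ n ≥ N, ∀ k ≥ n, x n ≤ x k) (hρ : Monotone ρ)
    (hρn : ∀ n ≥ N, n ≤ ρ n)
    (hinc : ∀ n ≥ N, x n + (F (n + 1) - F n) * x (ρ (n + 1)) ≤ x (n + 1))
    {t M : ℕ} (ht : N ≤ t) (hM : t ≤ M) :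
    x t + (F M - F t) * x (ρ (t + 1)) ≤ x M := by
  induction M, hM using Nat.le_induction with
  | base => simp
  | succ M hM ih =>
    have h₁ := hinc M (ht.trans hM)
    have h₂ : x (ρ (t + 1)) ≤ x (ρ (M + 1)) :=
      hx _ (by have := hρn (t + 1) (by omega); omega) _ (hρ (by omega))
    have h₃ : F M ≤ F (M + 1) := hF (by omega)
    nlinarith [mul_le_mul_of_nonneg_left h₂ (sub_nonneg.2 h₃)]

/-- If `d` is eventually a lower bound of `x t / x (ρ (t + 1))`, then so is
`a ^ 2 / (2 * (1 - a - d))`. -/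
lemma exists_ratio_bound_improved (hF : Monotone F) (hpos : ∀ n ≥ N, 0 < x n)
    (hx : ∀ n ≥ N, ∀ k ≥ n, x n ≤ x k) (hρ : Monotone ρ) (hρn : ∀ n ≥ N, n ≤ ρ n)
    (hinc : ∀ n ≥ N, x n + (F (n + 1) - F n) * x (ρ (n + 1)) ≤ x (n + 1))
    {a d : ℝ} (ha : 0 < a) (hmass : ∀ n ≥ N, a ≤ F (ρ n) - F n)
    (hd : 0 ≤ d) (hratio : ∀ t ≥ N, d * x (ρ (t + 1)) ≤ x t) :
    ∃ M, ∀ t ≥ M, a ^ 2 / 2 * x (ρ (t + 1)) ≤ (1 - a - d) * x t := by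
  refine ⟨ρ N, fun t ht => ?_⟩
  have hNt : N ≤ t := (hρn N le_rfl).trans ht
  have hX : 0 < x (ρ (t + 1)) := hpos _ (by have := hρn (t + 1) (by omega); omega)
  classical
  have hex : ∃ k, N ≤ k ∧ F t - F k < a := ⟨t, hNt, by simpa using ha⟩
  obtain ⟨k, ⟨hNk, hk⟩, hmin⟩ :
      ∃ k, (N ≤ k ∧ F t - F k < a) ∧ ∀ l < k, ¬ (N ≤ l ∧ F t - F l < a) :=
    ⟨Nat.find hex, Nat.find_spec hex, fun l hl => Nat.find_min hex hl⟩
  have hkt : k ≤ t := by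
    by_contra! h
    exact hmin t h ⟨hNt, by simpa using ha⟩
  have hkN : k ≠ N := by
    rintro rfl
    linarith [hmass k le_rfl, hF ht]
  obtain ⟨l, rfl⟩ : ∃ l, k = l + 1 := ⟨k - 1, by omega⟩
  have hNl : N ≤ l := by omega
  have hl : a ≤ F t - F l := by
    by_contra! h
    exact hmin l (by omega) ⟨hNl, h⟩
  have hfar : ∀ j, l + 1 ≤ j → t ≤ ρ j ∧
      x t + (a - (F t - F j)) * x (ρ (t + 1)) ≤ x (ρ j) := by
    intro j hj
    have h₁ := hmass j (by omega)
    have h₂ : F (l + 1) ≤ F j := hF hj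
    have h₃ : t ≤ ρ j := by
      by_contra! h
      linarith [hF h.le]
    refine ⟨h₃, ?_⟩
    have h₄ := add_mul_mass_le hF hx hρ hρn hinc hNt h₃
    nlinarith
  have hback : ∀ j, j ≤ t → l + 1 ≤ j →
      x j + (F t - F j) * x t + x (ρ (t + 1)) * (a ^ 2 - (a - (F t - F j)) ^ 2) / 2 ≤ x t := by
    intro j hj
    induction hj using Nat.decreasingInduction with
    | self => intro _; simp
    | of_succ j hj ih =>
      intro hlj
      have h₁ := ih (by omega)
      have h₂ := hinc j (by omega)
      have h₃ := (hfar (j + 1) (by omega)).2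
      have h₄ : 0 ≤ F (j + 1) - F j := sub_nonneg.2 (hF (by omega))
      nlinarith [mul_le_mul_of_nonneg_left h₃ h₄, mul_nonneg hX.le (sq_nonneg (F (j + 1) - F j))]
  have h₁ := hback (l + 1) hkt le_rfl
  obtain ⟨h₂, h₃⟩ := hfar (l + 1) le_rfl
  have h₄ := hinc l hNl
  have h₅ : x t ≤ x (ρ (l + 1)) := hx t hNt _ h₂
  have h₆ := hratio l hNl
  have h₇ := mul_le_mul_of_nonneg_left h₅ hd
  have h₈ : (a - (F t - F (l + 1))) * x (ρ (l + 1)) ≤ (F (l + 1) - F l) * x (ρ (l + 1)) :=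
    mul_le_mul_of_nonneg_right (by linarith) ((hpos t hNt).le.trans h₅)
  have h₉ := mul_le_mul_of_nonneg_left h₃ (sub_nonneg.2 hk.le)
  nlinarith [mul_nonneg hX.le (sq_nonneg (a - (F t - F (l + 1))))]

/-- Lower bound for the asymptotic ratio `x t / x (ρ (t + 1))`. -/
lemma eventually_ratio_bound (hF : Monotone F) (hpos : ∀ n ≥ N, 0 < x n)
    (hx : ∀ n ≥ N, ∀ k ≥ n, x n ≤ x k) (hρ : Monotone ρ) (hρn : ∀ n ≥ N, n ≤ ρ n)
    (hinc : ∀ n ≥ N, x n + (F (n + 1) - F n) * x (ρ (n + 1)) ≤ x (n + 1))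
    {α : ℝ} (hα : 0 < α) (hmass : ∀ a < α, ∀ᶠ n in atTop, a ≤ F (ρ n) - F n)
    {d : ℝ} (hd : d < (1 - α - Real.sqrt (1 - 2 * α - α ^ 2)) / 2) :
    ∀ᶠ t in atTop, d * x (ρ (t + 1)) ≤ x t := by
  have hρN : ∀ t ≥ N, t ≤ ρ (t + 1) := fun t ht => by
    have := hρn (t + 1) (by omega)
    omega
  set S : Set ℝ := {d | 0 ≤ d ∧ ∃ M, ∀ t ≥ M, d * x (ρ (t + 1)) ≤ x t} with hS
  have h0 : (0 : ℝ) ∈ S := ⟨le_rfl, N, fun t ht => by simpa using (hpos t ht).le⟩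
  have hbdd : BddAbove S := by
    refine ⟨1, ?_⟩
    rintro d ⟨-, M, hM⟩
    have ht : N ≤ max N M := le_max_left _ _
    have h₁ := hM (max N M) (le_max_right _ _)
    have h₂ := hx _ ht _ (hρN _ ht)
    by_contra! h
    nlinarith [hpos _ ht]
  set L := sSup S with hL
  have hL0 : 0 ≤ L := le_csSup hbdd h0
  have hstep : ∀ a, 0 < a → a < α → a ^ 2 / 2 ≤ L * (1 - a - L) := by
    intro a ha haα
    have key : ∀ d ∈ S, a ^ 2 / 2 ≤ L * (1 - a - d) := by
      rintro d ⟨hd, M, hM⟩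
      obtain ⟨K, hK⟩ := eventually_atTop.1 (hmass a haα)
      set N' := max N (max M K) with hN'
      have hNN' : N ≤ N' := le_max_left _ _
      obtain ⟨T, hT⟩ := exists_ratio_bound_improved (N := N') hF
        (fun n hn => hpos n (hNN'.trans hn)) (fun n hn => hx n (hNN'.trans hn)) hρ
        (fun n hn => hρn n (hNN'.trans hn)) (fun n hn => hinc n (hNN'.trans hn)) ha
        (fun n hn => hK n (by omega)) hd (fun t ht => hM t (by omega))
      have hc : 0 < 1 - a - d := by
        have ht : N ≤ max N T := le_max_left _ _
        have h₁ := hT (max N T) (le_max_right _ _)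
        have h₂ : 0 < a ^ 2 / 2 * x (ρ (max N T + 1)) :=
          mul_pos (by positivity) (hpos _ (ht.trans (hρN _ ht)))
        exact pos_of_mul_pos_left (h₂.trans_le h₁) (hpos _ ht).le
      have hmem : a ^ 2 / 2 / (1 - a - d) ∈ S := by
        refine ⟨by positivity, T, fun t ht => ?_⟩
        rw [div_mul_eq_mul_div, div_le_iff₀ hc]
        linarith [hT t ht]
      exact (div_le_iff₀ hc).1 (le_csSup hbdd hmem)
    refine le_of_forall_pos_le_add fun ε hε => ?_
    obtain ⟨d, hdS, hd⟩ := exists_lt_of_lt_csSup ⟨0, h0⟩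
      (show L - ε / (L + 1) < L from sub_lt_self _ (by positivity))
    have h₁ := key d hdS
    have h₂ : L * (L - d) ≤ (L + 1) * (ε / (L + 1)) :=
      mul_le_mul (by linarith) (by linarith)
        (sub_nonneg.2 (le_csSup hbdd hdS)) (by linarith)
    rw [mul_div_cancel₀ _ (by positivity)] at h₂
    linarith
  have hquad : α ^ 2 / 2 ≤ L * (1 - α - L) := by
    have hev : ∀ᶠ a in nhdsWithin α (Set.Iio α), a ^ 2 / 2 ≤ L * (1 - a - L) := by
      filter_upwards [Ioo_mem_nhdsLT hα] with a ha using hstep a ha.1 ha.2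
    refine le_of_tendsto_of_tendsto ?_ ?_ hev
    · exact (Continuous.tendsto (f := fun a : ℝ => a ^ 2 / 2) (by fun_prop) α).mono_left
        nhdsWithin_le_nhds
    · exact (Continuous.tendsto (f := fun a : ℝ => L * (1 - a - L)) (by fun_prop) α).mono_left
        nhdsWithin_le_nhds
  have hdL : d < L := by
    have := Real.le_sqrt_of_sq_le
      (show (1 - α - 2 * L) ^ 2 ≤ 1 - 2 * α - α ^ 2 by nlinarith)
    linarith
  obtain ⟨d', ⟨-, M, hM⟩, hd'⟩ := exists_lt_of_lt_csSup ⟨0, h0⟩ hdL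
  filter_upwards [eventually_ge_atTop (max N M)] with t ht
  have hNt : N ≤ t := (le_max_left _ _).trans ht
  exact (mul_le_mul_of_nonneg_right hd'.le (hpos _ (hNt.trans (hρN t hNt))).le).trans
    (hM t ((le_max_right _ _).trans ht))

end Comparison

section Advanced

variable {m : ℕ} {p : Fin m → ℕ → ℝ} {σ : Fin m → ℕ → ℕ}

lemma rhoi_le {i : Fin m} {n s : ℕ} (h : n ≤ s) : rhoi σ i n ≤ σ i s :=
  Nat.sInf_le ⟨s, h, rfl⟩

lemma exists_rhoi_eq (i : Fin m) (n : ℕ) : ∃ s ≥ n, rhoi σ i n = σ i s := by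
  obtain ⟨s, hs, h⟩ := Nat.sInf_mem (s := σ i '' Set.Ici n) ⟨_, n, Set.self_mem_Ici, rfl⟩
  exact ⟨s, hs, h.symm⟩

lemma rho_le [NeZero m] (i : Fin m) {n s : ℕ} (h : n ≤ s) : rho σ n ≤ σ i s :=
  (Finset.inf'_le _ (mem_univ i)).trans (rhoi_le h)

lemma exists_rho_eq [NeZero m] (σ : Fin m → ℕ → ℕ) (n : ℕ) : ∃ i, rho σ n = rhoi σ i n := by
  obtain ⟨i, -, h⟩ := Finset.exists_mem_eq_inf' (univ_nonempty (α := Fin m))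
    (fun i => rhoi σ i n)
  exact ⟨i, h⟩

lemma rho_mono [NeZero m] : Monotone (rho σ) := by
  intro a b hab
  obtain ⟨i, hi⟩ := exists_rho_eq σ b
  obtain ⟨s, hs, h⟩ := exists_rhoi_eq (σ := σ) i b
  rw [hi, h]
  exact rho_le i (hab.trans hs)

lemma lt_rho [NeZero m] (hσ : ∀ i : Fin m, ∀ n : ℕ, 1 ≤ n → n + 1 ≤ σ i n) {n : ℕ} (hn : 1 ≤ n) :
    n < rho σ n := by
  obtain ⟨i, hi⟩ := exists_rho_eq σ n
  obtain ⟨s, hs, h⟩ := exists_rhoi_eq (σ := σ) i n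
  have := hσ i s (hn.trans hs)
  omega

/-- An eventually positive solution is controlled by a product whose factors bound its
one-step ratios. -/
lemma prod_pos_and_le_prod_mul {x g : ℕ → ℝ} {N : ℕ} (hpos : ∀ n ≥ N, 0 < x n)
    (hg : ∀ n ≥ N, x n ≤ g (n + 1) * x (n + 1)) {n k : ℕ} (hn : N ≤ n) (hk : n ≤ k) :
    0 < ∏ i ∈ Icc (n + 1) k, g i ∧ x n ≤ (∏ i ∈ Icc (n + 1) k, g i) * x k := by
  induction k, hk using Nat.le_induction with
  | base => simp
  | succ k hk ih =>
    obtain ⟨h₁, h₂⟩ := ih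
    have h₃ := hg k (hn.trans hk)
    have h₄ : 0 < g (k + 1) :=
      pos_of_mul_pos_left ((hpos k (hn.trans hk)).trans_le h₃) (hpos _ (by omega)).le
    rw [Finset.prod_Icc_succ_top (by omega)]
    exact ⟨mul_pos h₁ h₄, by nlinarith [mul_le_mul_of_nonneg_left h₃ h₁.le]⟩

lemma bA_pos_and_le_bA_mul (hp : ∀ i : Fin m, ∀ n : ℕ, 0 ≤ p i n)
    (hσ : ∀ i : Fin m, ∀ n : ℕ, 1 ≤ n → n + 1 ≤ σ i n) {x : ℕ → ℝ} {N : ℕ}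
    (hpos : ∀ n ≥ N, 0 < x n) (hx : ∀ n ≥ N, ∀ k ≥ n, x n ≤ x k)
    (heq : ∀ n, x (n + 1) - x n = ∑ i : Fin m, p i (n + 1) * x (σ i (n + 1)))
    (r : ℕ) {n k : ℕ} (hn : N ≤ n) (hk : n ≤ k) :
    0 < bA p σ r n k ∧ x n ≤ bA p σ r n k * x k := by
  induction r generalizing n k with
  | zero =>
    rw [bA]
    refine prod_pos_and_le_prod_mul hpos (fun j hj => ?_) hn hk
    have h : ∑ i : Fin m, p i (j + 1) * x (j + 1) ≤
        ∑ i : Fin m, p i (j + 1) * x (σ i (j + 1)) :=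
      Finset.sum_le_sum fun i _ => mul_le_mul_of_nonneg_left
        (hx _ (by omega) _ (by have := hσ i (j + 1) (by omega); omega)) (hp i _)
    rw [← Finset.sum_mul] at h
    linarith [heq j]
  | succ r ih =>
    rw [bA]
    refine prod_pos_and_le_prod_mul (g := fun j => 1 - ∑ l : Fin m, p l j * (bA p σ r j (σ l j))⁻¹)
      hpos (fun j hj => ?_) hn hk
    have h : ∑ i : Fin m, p i (j + 1) * (bA p σ r (j + 1) (σ i (j + 1)))⁻¹ * x (j + 1) ≤
        ∑ i : Fin m, p i (j + 1) * x (σ i (j + 1)) := by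
      refine Finset.sum_le_sum fun i _ => ?_
      obtain ⟨h₁, h₂⟩ := ih (n := j + 1) (k := σ i (j + 1)) (by omega)
        (by have := hσ i (j + 1) (by omega); omega)
      rw [mul_assoc]
      exact mul_le_mul_of_nonneg_left ((inv_mul_le_iff₀ h₁).2 h₂) (hp i _)
    rw [← Finset.sum_mul] at h
    linarith [heq j]

lemma sum_Icc_succ_eq_sub {f : ℕ → ℝ} {n k : ℕ} (h : n ≤ k) :
    ∑ j ∈ Icc (n + 1) k, f j = ∑ j ∈ range (k + 1), f j - ∑ j ∈ range (n + 1), f j := by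
  rw [← Finset.sum_Ico_eq_sub _ (by omega)]
  rfl

/-- Under the hypotheses of the oscillation criterion there is no eventually positive solution. -/
lemma not_eventually_pos [NeZero m] (hp : ∀ i : Fin m, ∀ n : ℕ, 0 ≤ p i n)
    (hσ : ∀ i : Fin m, ∀ n : ℕ, 1 ≤ n → n + 1 ≤ σ i n)
    {α : ℝ}
    (hα : α = Finset.univ.inf' Finset.univ_nonempty (fun i : Fin m =>
        Filter.liminf (fun n : ℕ => ∑ j ∈ Finset.Icc (n + 1) (rhoi σ i n), p i j) Filter.atTop))
    (hα0 : 0 < α) {r : ℕ}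
    (hcond : 1 - (1 - α - Real.sqrt (1 - 2 * α - α ^ 2)) / 2 <
      Filter.limsup (fun n : ℕ =>
        ∑ j ∈ Finset.Icc n (rho σ n), ∑ i : Fin m, p i j * (bA p σ r (rho σ n) (σ i j))⁻¹)
      Filter.atTop)
    {x : ℕ → ℝ}
    (hxeq : ∀ n : ℕ, 1 ≤ n → x n - x (n - 1) - ∑ i : Fin m, p i n * x (σ i n) = 0) :
    ¬ ∃ N : ℕ, ∀ n ≥ N, 0 < x n := by
  rintro ⟨N₀, hN₀⟩
  obtain ⟨N, hN1, hpos⟩ : ∃ N ≥ 1, ∀ n ≥ N, 0 < x n :=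
    ⟨N₀ + 1, by omega, fun n hn => hN₀ n (by omega)⟩
  have heq : ∀ n, x (n + 1) - x n = ∑ i : Fin m, p i (n + 1) * x (σ i (n + 1)) := fun n => by
    have := hxeq (n + 1) (by omega)
    rw [Nat.add_sub_cancel] at this
    linarith
  have hx : ∀ n ≥ N, ∀ k ≥ n, x n ≤ x k := by
    intro n hn k hk
    induction k, hk using Nat.le_induction with
    | base => exact le_rfl
    | succ k hk ih =>
      have : 0 ≤ ∑ i : Fin m, p i (k + 1) * x (σ i (k + 1)) :=
        Finset.sum_nonneg fun i _ => mul_nonneg (hp i _)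
          (hpos _ (by have := hσ i (k + 1) (by omega); omega)).le
      linarith [heq k]
  set F : ℕ → ℝ := fun n => ∑ j ∈ range (n + 1), ∑ i : Fin m, p i j with hFdef
  have hP : ∀ j, 0 ≤ ∑ i : Fin m, p i j := fun j => Finset.sum_nonneg fun i _ => hp i j
  have hFsucc : ∀ n, F (n + 1) - F n = ∑ i : Fin m, p i (n + 1) := fun n => by
    simp only [hFdef]
    rw [Finset.sum_range_succ _ (n + 1)]
    ring
  have hF : Monotone F := monotone_nat_of_le_succ fun n => by
    linarith [hFsucc n, hP (n + 1)]
  have hρn : ∀ n ≥ N, n ≤ rho σ n := fun n hn => (lt_rho hσ (hN1.trans hn)).le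
  have hinc : ∀ n ≥ N, x n + (F (n + 1) - F n) * x (rho σ (n + 1)) ≤ x (n + 1) := by
    intro n hn
    have h : ∑ i : Fin m, p i (n + 1) * x (rho σ (n + 1)) ≤
        ∑ i : Fin m, p i (n + 1) * x (σ i (n + 1)) :=
      Finset.sum_le_sum fun i _ => mul_le_mul_of_nonneg_left
        (hx _ (by have := hρn (n + 1) (by omega); omega) _ (rho_le i le_rfl)) (hp i _)
    rw [← Finset.sum_mul] at h
    rw [hFsucc]
    linarith [heq n]
  have hmass : ∀ a < α, ∀ᶠ n in atTop, a ≤ F (rho σ n) - F n := by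
    intro a ha
    have hi : ∀ i : Fin m, ∀ᶠ n in atTop, a ≤ ∑ j ∈ Icc (n + 1) (rhoi σ i n), p i j := by
      intro i
      have h₁ : a < liminf (fun n : ℕ => ∑ j ∈ Icc (n + 1) (rhoi σ i n), p i j) atTop :=
        ha.trans_le (hα.trans_le (Finset.inf'_le _ (mem_univ i)))
      refine (eventually_lt_of_lt_liminf h₁ ?_).mono fun n hn => hn.le
      exact isBoundedUnder_of ⟨0, fun n => Finset.sum_nonneg fun j _ => hp i j⟩
    filter_upwards [eventually_all.2 hi, eventually_ge_atTop N] with n hn hNn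
    obtain ⟨i, h⟩ := exists_rho_eq σ n
    rw [hFdef, ← sum_Icc_succ_eq_sub (hρn n hNn)]
    refine (hn i).trans ?_
    rw [← h]
    exact Finset.sum_le_sum fun j _ =>
      Finset.single_le_sum (f := fun i => p i j) (fun i _ => hp i j) (mem_univ i)
  obtain ⟨c, hc₁, hc₂⟩ := exists_between hcond
  have hratio := eventually_ratio_bound hF hpos hx rho_mono hρn hinc hα0 hmass
    (d := 1 - c) (by linarith)
  refine hc₂.not_ge (limsup_le_of_le ?_ ?_)
  · refine IsCoboundedUnder.of_frequently_ge (a := 0) (Eventually.frequently ?_)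
    filter_upwards [eventually_ge_atTop N] with n hn
    refine Finset.sum_nonneg fun j hj => Finset.sum_nonneg fun i _ => mul_nonneg (hp i j) ?_
    exact (inv_pos.2 (bA_pos_and_le_bA_mul hp hσ hpos hx heq r (hn.trans (hρn n hn))
      (rho_le i (mem_Icc.1 hj).1)).1).le
  · filter_upwards [(tendsto_sub_atTop_nat 1).eventually hratio,
      eventually_ge_atTop (N + 1)] with n hn hNn
    obtain ⟨t, rfl⟩ : ∃ t, n = t + 1 := ⟨n - 1, by omega⟩
    rw [Nat.add_sub_cancel] at hn
    have hle : t + 1 ≤ rho σ (t + 1) := hρn _ (by omega)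
    have hX : 0 < x (rho σ (t + 1)) := hpos _ (by omega)
    have htel : ∀ k ≥ t, ∑ j ∈ Icc (t + 1) k, ∑ i : Fin m, p i j * x (σ i j) = x k - x t := by
      intro k hk
      induction k, hk using Nat.le_induction with
      | base => simp
      | succ k hk ih =>
        rw [Finset.sum_Icc_succ_top (by omega), ih, ← heq k]
        ring
    have h : (∑ j ∈ Icc (t + 1) (rho σ (t + 1)),
        ∑ i : Fin m, p i j * (bA p σ r (rho σ (t + 1)) (σ i j))⁻¹) * x (rho σ (t + 1)) ≤
        ∑ j ∈ Icc (t + 1) (rho σ (t + 1)), ∑ i : Fin m, p i j * x (σ i j) := by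
      simp only [Finset.sum_mul]
      refine Finset.sum_le_sum fun j hj => Finset.sum_le_sum fun i _ => ?_
      obtain ⟨h₁, h₂⟩ := bA_pos_and_le_bA_mul hp hσ hpos hx heq r
        (n := rho σ (t + 1)) (by omega) (rho_le i (mem_Icc.1 hj).1)
      rw [mul_assoc]
      exact mul_le_mul_of_nonneg_left ((inv_mul_le_iff₀ h₁).2 h₂) (hp i _)
    rw [htel _ (by omega)] at h
    refine le_of_mul_le_mul_right (h.trans ?_) hX
    linarith

end Advanced

/-- Theorem 2.5′: if `∑_i p_i(n) < 1` for all `n`,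
`α = min_i liminf_{n→∞} ∑_{j=n+1}^{ρ_i(n)} p_i(j)` satisfies `0 < α ≤ 1/e`, and for some
`r ∈ ℕ`, `limsup_{n→∞} ∑_{j=n}^{ρ(n)} ∑_i p_i(j) b_r(ρ(n), σ_i(j))⁻¹ >
1 - (1 - α - √(1 - 2α - α²))/2`, then every solution of the advanced equation oscillates. -/
theorem stmt_8 {m : ℕ} [NeZero m] (p : Fin m → ℕ → ℝ) (σ : Fin m → ℕ → ℕ)
    (hp : ∀ i : Fin m, ∀ n : ℕ, 0 ≤ p i n)
    (hσ : ∀ i : Fin m, ∀ n : ℕ, 1 ≤ n → n + 1 ≤ σ i n)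
    (hsum : ∀ n : ℕ, ∑ i : Fin m, p i n < 1)
    (α : ℝ)
    (hα : α = Finset.univ.inf' Finset.univ_nonempty (fun i : Fin m =>
        Filter.liminf (fun n : ℕ => ∑ j ∈ Finset.Icc (n + 1) (rhoi σ i n), p i j) Filter.atTop))
    (hα0 : 0 < α) (hα1 : α ≤ 1 / Real.exp 1)
    (r : ℕ)
    (hcond : 1 - (1 - α - Real.sqrt (1 - 2 * α - α ^ 2)) / 2 <
      Filter.limsup (fun n : ℕ =>
        ∑ j ∈ Finset.Icc n (rho σ n), ∑ i : Fin m, p i j * (bA p σ r (rho σ n) (σ i j))⁻¹)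
      Filter.atTop)
    (x : ℕ → ℝ)
    (hxeq : ∀ n : ℕ, 1 ≤ n → x n - x (n - 1) - ∑ i : Fin m, p i n * x (σ i n) = 0) :
    (¬ ∃ N : ℕ, ∀ n ≥ N, 0 < x n) ∧ (¬ ∃ N : ℕ, ∀ n ≥ N, x n < 0) := by
  refine ⟨not_eventually_pos hp hσ hα hα0 hcond hxeq, ?_⟩
  rintro ⟨N, hN⟩
  refine not_eventually_pos hp hσ hα hα0 hcond (x := fun n => -x n) (fun n hn => ?_)
    ⟨N, fun n hn => neg_pos.2 (hN n hn)⟩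
  simp only [mul_neg, Finset.sum_neg_distrib]
  linarith [hxeq n hn]
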